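/- For d = 9, the sign pattern Σ_{3,4,3} is not realizable with the pair (0, 7): there is no monic real polynomial of degree 9 whose coefficients of x^9, x^8, x^7 are positive, coefficients of x^6, x^5, x^4, x^3 are negative, coefficients of x^2, x^1, x^0 are positive, and which has exactly 7 distinct negative roots, all simple, and no other real roots. -/

import Mathlib

open Polynomial

/-- A real polynomial `P` realizes the pair `(pos, neg)` if it has exactly `pos`
distinct positive roots and exactly `neg` distinct negative roots, all of them
simple, and no other real roots. -/
def realizesPair (P : Polynomial ℝ) (pos neg : ℕ) : Prop :=
  P.roots.Nodup ∧
  (P.roots.filter (fun x => 0 < x)).card = pos ∧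
  (P.roots.filter (fun x => x < 0)).card = neg ∧
  (0 : ℝ) ∉ P.roots

/-- Schur's inequality of degree three. -/
theorem schur_nonneg {x y z : ℝ} (hx : 0 ≤ x) (hy : 0 ≤ y) (hz : 0 ≤ z) :
    0 ≤ x * (x - y) * (x - z) + y * (y - x) * (y - z) + z * (z - x) * (z - y) := by
  have ordered : ∀ a b c : ℝ, 0 ≤ c → c ≤ b → b ≤ a →
      0 ≤ a * (a - b) * (a - c) + b * (b - a) * (b - c) + c * (c - a) * (c - b) := by
    intro a b c hc hcb hba
    have h₁ : 0 ≤ (a - b) ^ 2 * (a + b - c) := mul_nonneg (sq_nonneg _) (by linarith)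
    have h₂ : 0 ≤ c * ((a - c) * (b - c)) :=
      mul_nonneg hc (mul_nonneg (by linarith) (by linarith))
    linear_combination h₁ + h₂
  rcases le_total x y with h₁ | h₁ <;> rcases le_total y z with h₂ | h₂ <;>
    rcases le_total x z with h₃ | h₃
  · linear_combination ordered z y x hx h₁ h₂
  · linear_combination ordered z y x hx h₁ h₂
  · linear_combination ordered y z x hx h₃ h₂
  · linear_combination ordered y x z hz h₃ h₁
  · linear_combination ordered z x y hy h₁ h₃
  · linear_combination ordered x z y hy h₂ h₃
  · linear_combination ordered x y z hz h₂ h₁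
  · linear_combination ordered x y z hz h₂ h₁

namespace Polynomial

/-- Rolle's theorem: differentiation preserves real-rootedness. -/
theorem Splits.derivative_real {p : ℝ[X]} (hp : p.Splits) : (derivative p).Splits := by
  rw [splits_iff_card_roots]
  apply le_antisymm (card_roots' _)
  have h := card_roots_le_derivative p
  rw [← hp.natDegree_eq_card_roots] at h
  have := natDegree_derivative_le p
  omega

/-- Reversing the coefficients preserves splitting. -/
theorem Splits.reverse {K : Type*} [Field K] {p : K[X]} (hp : p.Splits) : p.reverse.Splits := by
  obtain ⟨m, hm⟩ := splits_iff_exists_multiset'.1 hp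
  have hprod : ∀ m : Multiset K, (m.map fun a => X + C a).prod.reverse.Splits := by
    intro m
    induction m using Multiset.induction_on with
    | empty =>
      rw [Multiset.map_zero, Multiset.prod_zero, ← C_1, reverse_C]
      exact Splits.C 1
    | cons a m ih =>
      rw [Multiset.map_cons, Multiset.prod_cons, reverse_mul_of_domain]
      refine Splits.mul (Splits.of_natDegree_le_one ?_) ih
      exact (reverse_natDegree_le _).trans (natDegree_X_add_C a).le
  rw [hm, reverse_mul_of_domain, reverse_C]
  exact (hprod m).C_mul _

theorem coeff_X_add_C_prod_pos (m : Multiset ℝ) (hm : ∀ a ∈ m, 0 < a) :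
    ∀ k ≤ m.card, 0 < (m.map fun a => X + C a).prod.coeff k := by
  induction m using Multiset.induction_on with
  | empty => intro k hk; simp_all
  | cons a m ih =>
    have ih := ih fun b hb => hm b (Multiset.mem_cons_of_mem hb)
    have ha : 0 < a := hm a (Multiset.mem_cons_self a m)
    have hdeg : (m.map fun a => X + C a).prod.natDegree = m.card := by
      simpa [sub_eq_add_neg] using natDegree_multiset_prod_X_sub_C_eq_card (m.map Neg.neg)
    intro k hk
    rw [Multiset.card_cons] at hk
    rw [Multiset.map_cons, Multiset.prod_cons, add_mul, coeff_add, coeff_C_mul]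
    cases k with
    | zero => simpa using mul_pos ha (ih 0 (Nat.zero_le _))
    | succ k =>
      rw [coeff_X_mul]
      refine add_pos_of_pos_of_nonneg (ih k (by omega)) (mul_nonneg ha.le ?_)
      by_cases hk' : k + 1 ≤ m.card
      · exact (ih _ hk').le
      · rw [coeff_eq_zero_of_natDegree_lt (by omega)]

/-- Inequalities between the coefficients of a real-rooted cubic with positive coefficients;
the first one combines Schur's inequality with `3 (xy + yz + zx) ≤ (x + y + z)²`. -/
theorem Splits.cubic_coeff_ineq {p : ℝ[X]} (hp : p.Splits) (hdeg : p.natDegree = 3)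
    (hpos : ∀ k ≤ 3, 0 < p.coeff k) :
    18 * p.coeff 3 * p.coeff 2 * p.coeff 1 ≤ 5 * p.coeff 2 ^ 3 + 27 * p.coeff 3 ^ 2 * p.coeff 0 ∧
    9 * p.coeff 3 * p.coeff 0 ≤ p.coeff 2 * p.coeff 1 ∧
    3 * p.coeff 3 * p.coeff 1 ≤ p.coeff 2 ^ 2 := by
  have hcard := hp.natDegree_eq_card_roots
  rw [hdeg] at hcard
  obtain ⟨α, β, γ, hr⟩ := Multiset.card_eq_three.1 hcard.symm
  have hneg : ∀ x ∈ p.roots, 0 < -x := by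
    intro x hx
    by_contra! h
    have hx0 : 0 ≤ x := by linarith
    have h0 : p.eval x = 0 := (mem_roots'.1 hx).2
    rw [eval_eq_sum_range, hdeg] at h0
    simp only [Finset.sum_range_succ, Finset.sum_range_zero] at h0
    have := hpos 0 (by norm_num)
    have := mul_nonneg (hpos 1 (by norm_num)).le (pow_nonneg hx0 1)
    have := mul_nonneg (hpos 2 (by norm_num)).le (pow_nonneg hx0 2)
    have := mul_nonneg (hpos 3 (by norm_num)).le (pow_nonneg hx0 3)
    linarith
  have heq := hp.eq_prod_roots
  have hl : 0 < p.leadingCoeff := by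
    rw [leadingCoeff, hdeg]; exact hpos 3 le_rfl
  generalize p.leadingCoeff = l at heq hl
  rw [hr] at heq hneg
  obtain ⟨x, rfl⟩ : ∃ x, α = -x := ⟨-α, by ring⟩
  obtain ⟨y, rfl⟩ : ∃ x, β = -x := ⟨-β, by ring⟩
  obtain ⟨z, rfl⟩ : ∃ x, γ = -x := ⟨-γ, by ring⟩
  have hx : 0 < x := by simpa using hneg (-x) (by simp)
  have hy : 0 < y := by simpa using hneg (-y) (by simp)
  have hz : 0 < z := by simpa using hneg (-z) (by simp)
  have hp' : p = C l * X ^ 3 + C (l * (x + y + z)) * X ^ 2 +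
      C (l * (x * y + y * z + z * x)) * X + C (l * (x * y * z)) := by
    rw [heq]
    simp only [Multiset.insert_eq_cons, Multiset.map_cons, Multiset.map_singleton,
      Multiset.prod_cons, Multiset.prod_singleton, C_neg, C_mul, C_add]
    ring
  have c3 : p.coeff 3 = l := by
    rw [hp', coeff_add, coeff_add, coeff_add, coeff_C_mul_X_pow, coeff_C_mul_X_pow, coeff_C_mul_X,
      coeff_C]
    simp
  have c2 : p.coeff 2 = l * (x + y + z) := by
    rw [hp', coeff_add, coeff_add, coeff_add, coeff_C_mul_X_pow, coeff_C_mul_X_pow, coeff_C_mul_X,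
      coeff_C]
    simp
  have c1 : p.coeff 1 = l * (x * y + y * z + z * x) := by
    rw [hp', coeff_add, coeff_add, coeff_add, coeff_C_mul_X_pow, coeff_C_mul_X_pow, coeff_C_mul_X,
      coeff_C]
    simp
  have c0 : p.coeff 0 = l * (x * y * z) := by
    rw [hp', coeff_add, coeff_add, coeff_add, coeff_C_mul_X_pow, coeff_C_mul_X_pow, coeff_C_mul_X,
      coeff_C]
    simp
  have hsq : 3 * (x * y + y * z + z * x) ≤ (x + y + z) ^ 2 := by
    nlinarith [sq_nonneg (x - y), sq_nonneg (y - z), sq_nonneg (z - x)]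
  have hschur := schur_nonneg hx.le hy.le hz.le
  rw [c3, c2, c1, c0]
  refine ⟨?_, ?_, ?_⟩
  · have h := mul_nonneg (pow_pos hl 3).le (add_nonneg (mul_nonneg zero_le_three hschur)
      (mul_nonneg (add_pos (add_pos hx hy) hz).le (mul_nonneg zero_le_two (sub_nonneg.2 hsq))))
    linear_combination h
  · have h := mul_nonneg (pow_pos hl 2).le (add_nonneg (add_nonneg
      (mul_nonneg hx.le (sq_nonneg (y - z))) (mul_nonneg hy.le (sq_nonneg (x - z))))
      (mul_nonneg hz.le (sq_nonneg (x - y))))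
    linear_combination h
  · have h := mul_nonneg (pow_pos hl 2).le (sub_nonneg.2 hsq)
    linear_combination h

/-- Inequalities between consecutive coefficients of a real-rooted polynomial of degree seven with
positive coefficients, obtained by reducing it to a cubic through differentiation and reversal. -/
theorem Splits.septic_coeff_ineq {p : ℝ[X]} (hp : p.Splits) (hdeg : p.natDegree = 7)
    (hpos : ∀ k ≤ 7, 0 < p.coeff k) :
    2 * p.coeff 3 * p.coeff 4 * p.coeff 5 ≤ p.coeff 4 ^ 3 + p.coeff 3 ^ 2 * p.coeff 6 ∧
    p.coeff 3 * p.coeff 6 ≤ p.coeff 4 * p.coeff 5 ∧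
    p.coeff 3 * p.coeff 5 ≤ p.coeff 4 ^ 2 := by
  set q := derivative (derivative (derivative p)) with hq
  have hqs : q.Splits := hp.derivative_real.derivative_real.derivative_real
  have hqdeg : q.natDegree = 4 := by
    simp [hq, natDegree_derivative, hdeg]
  have hqc : ∀ k, q.coeff k = p.coeff (k + 3) * (k + 3) * (k + 2) * (k + 1) := by
    intro k
    simp only [hq, coeff_derivative]
    push_cast
    ring
  set r := derivative q.reverse with hr
  have hrs : r.Splits := hqs.reverse.derivative_real
  have hqrc : ∀ k ≤ 4, q.reverse.coeff k = q.coeff (4 - k) := by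
    intro k hk
    rw [coeff_reverse, hqdeg, revAt_le hk]
  have r0 : r.coeff 0 = 120 * p.coeff 6 := by
    rw [hr, coeff_derivative, hqrc _ (by norm_num), hqc]; norm_num; ring
  have r1 : r.coeff 1 = 120 * p.coeff 5 := by
    rw [hr, coeff_derivative, hqrc _ (by norm_num), hqc]; norm_num; ring
  have r2 : r.coeff 2 = 72 * p.coeff 4 := by
    rw [hr, coeff_derivative, hqrc _ (by norm_num), hqc]; norm_num; ring
  have r3 : r.coeff 3 = 24 * p.coeff 3 := by
    rw [hr, coeff_derivative, hqrc _ (by norm_num), hqc]; norm_num; ring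
  have h3 := hpos 3 (by norm_num)
  have h4 := hpos 4 (by norm_num)
  have h5 := hpos 5 (by norm_num)
  have h6 := hpos 6 (by norm_num)
  have hrdeg : r.natDegree = 3 := by
    apply natDegree_eq_of_le_of_coeff_ne_zero
    · have h₁ : r.natDegree ≤ q.reverse.natDegree - 1 := natDegree_derivative_le q.reverse
      have h₂ := reverse_natDegree_le q
      omega
    · rw [r3]; positivity
  have hrpos : ∀ k ≤ 3, 0 < r.coeff k := by
    intro k hk
    interval_cases k
    · rw [r0]; positivity
    · rw [r1]; positivity
    · rw [r2]; positivity
    · rw [r3]; positivity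
  obtain ⟨i₁, i₂, i₃⟩ := hrs.cubic_coeff_ineq hrdeg hrpos
  rw [r3, r2, r1, r0] at i₁
  rw [r3, r2, r1, r0] at i₂
  rw [r3, r2, r1] at i₃
  have := mul_pos h4 h5
  have := pow_pos h4 2
  refine ⟨?_, ?_, ?_⟩
  · linear_combination i₁ / 1866240
  · nlinarith
  · nlinarith

/-- A monic real quadratic without real roots has negative discriminant. -/
theorem Monic.coeff_one_sq_lt {q : ℝ[X]} (hq : q.Monic) (hdeg : q.natDegree = 2)
    (hroots : q.roots = 0) : q.coeff 1 ^ 2 < 4 * q.coeff 0 := by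
  by_contra! h
  have h2 : q.coeff 2 = 1 := hdeg ▸ hq.coeff_natDegree
  set s := √(q.coeff 1 ^ 2 - 4 * q.coeff 0)
  have hs : s ^ 2 = q.coeff 1 ^ 2 - 4 * q.coeff 0 := Real.sq_sqrt (by linarith)
  have hmem : (-q.coeff 1 + s) / 2 ∈ q.roots := by
    rw [mem_roots hq.ne_zero, IsRoot, eval_eq_sum_range, hdeg]
    simp only [Finset.sum_range_succ, Finset.sum_range_zero, h2]
    linear_combination hs / 4
  simp [hroots] at hmem

end Polynomial

/-- If both quadratics `e₁ t² + b e₂ t + e₃` and `e₄ t² + b e₅ t + e₆` were negative at the same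
scale, then that scale would lie strictly on both sides of `e₄ / e₃`. -/
theorem not_both_quadratics_neg {e₁ e₂ e₃ e₄ e₅ e₆ b c : ℝ} (h₁ : 0 < e₁) (h₂ : 0 < e₂)
    (h₃ : 0 < e₃) (h₄ : 0 < e₄) (h₅ : 0 < e₅)
    (hF : 2 * e₄ * e₃ * e₂ ≤ e₃ ^ 3 + e₄ ^ 2 * e₁) (hF' : e₄ * e₁ ≤ e₃ * e₂)
    (hG : 2 * e₃ * e₄ * e₅ ≤ e₄ ^ 3 + e₃ ^ 2 * e₆) (hG' : e₃ * e₅ ≤ e₄ ^ 2)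
    (hbc : b ^ 2 < 4 * c) (hf : e₃ + b * e₂ + c * e₁ < 0) (hg : e₆ + b * e₅ + c * e₄ < 0) :
    False := by
  have hc : 0 < c := by nlinarith [sq_nonneg b]
  obtain ⟨t, ht, rfl⟩ : ∃ t, 0 < t ∧ c = t ^ 2 := ⟨√c, Real.sqrt_pos.2 hc, (Real.sq_sqrt hc.le).symm⟩
  have hb : -(2 * t) ≤ b := (abs_le_of_sq_le_sq' (by nlinarith) (by linarith)).1
  have hf : e₁ * t ^ 2 - 2 * t * e₂ + e₃ < 0 := by nlinarith
  have hg : e₄ * t ^ 2 - 2 * t * e₅ + e₆ < 0 := by nlinarith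
  obtain ⟨u, rfl⟩ : ∃ u, e₄ = u * e₃ := ⟨e₄ / e₃, by field_simp⟩
  have hu : 0 < u := pos_of_mul_pos_left h₄ h₃.le
  have hFu : 0 ≤ e₁ * u ^ 2 - 2 * u * e₂ + e₃ := by
    have : 0 ≤ e₃ ^ 2 * (e₁ * u ^ 2 - 2 * u * e₂ + e₃) := by linarith
    exact nonneg_of_mul_nonneg_right this (by positivity)
  have hGu : 0 ≤ u * e₃ * u ^ 2 - 2 * u * e₅ + e₆ := by
    have : 0 ≤ e₃ ^ 2 * (u * e₃ * u ^ 2 - 2 * u * e₅ + e₆) := by linarith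
    exact nonneg_of_mul_nonneg_right this (by positivity)
  have hFv : u * e₁ ≤ e₂ := by
    have : e₃ * (u * e₁) ≤ e₃ * e₂ := by linarith
    exact le_of_mul_le_mul_left this h₃
  have hGv : e₅ ≤ u ^ 2 * e₃ := by
    have : e₃ * e₅ ≤ e₃ * (u ^ 2 * e₃) := by linarith
    exact le_of_mul_le_mul_left this h₃
  rcases le_total t u with htu | htu
  · have : 0 ≤ (u - t) * (2 * e₂ - e₁ * (t + u)) :=
      mul_nonneg (by linarith) (by nlinarith)
    linarith
  · have : 0 ≤ (t - u) * (u * e₃ * (t + u) - 2 * e₅) :=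
      mul_nonneg (by linarith) (by nlinarith [mul_pos hu h₃])
    linarith

/-- For `d = 9`, the sign pattern `Σ_{3,4,3}` is not realizable with the pair
`(0, 7)`. -/
theorem stmt8 :
    ¬ ∃ P : Polynomial ℝ, P.Monic ∧ P.natDegree = 9 ∧
      0 < P.coeff 9 ∧ 0 < P.coeff 8 ∧ 0 < P.coeff 7 ∧
      P.coeff 6 < 0 ∧ P.coeff 5 < 0 ∧ P.coeff 4 < 0 ∧ P.coeff 3 < 0 ∧
      0 < P.coeff 2 ∧ 0 < P.coeff 1 ∧ 0 < P.coeff 0 ∧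
      realizesPair P 0 7 := by
  rintro ⟨P, hP, hdeg, -, -, -, h6, -, -, h3, -, -, -, -, hpos, hneg, h0⟩
  have hlt : ∀ x ∈ P.roots, x < 0 := by
    intro x hx
    rw [Multiset.card_eq_zero, Multiset.filter_eq_nil] at hpos
    exact lt_of_le_of_ne (not_lt.1 (hpos x hx)) fun h => h0 (h ▸ hx)
  have hcard : P.roots.card = 7 := by
    rwa [Multiset.filter_eq_self.2 hlt] at hneg
  obtain ⟨Q, hPQ, hQdeg, hQroots⟩ := exists_prod_multiset_X_sub_C_mul P
  obtain ⟨A, hA⟩ : ∃ A, A = (P.roots.map fun a => X - C a).prod := ⟨_, rfl⟩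
  rw [← hA] at hPQ
  have hA' : A = ((P.roots.map Neg.neg).map fun a => X + C a).prod := by
    simp [hA, sub_eq_add_neg]
  have hAmonic : A.Monic := hA ▸ monic_multiset_prod_of_monic _ _ fun a _ => monic_X_sub_C a
  have hAdeg : A.natDegree = 7 := by
    rw [hA, natDegree_multiset_prod_X_sub_C_eq_card, hcard]
  have hAsplits : A.Splits := by
    rw [hA]
    refine Splits.multisetProd fun f hf => ?_
    obtain ⟨a, -, rfl⟩ := Multiset.mem_map.1 hf
    exact Splits.X_sub_C a
  have hApos : ∀ k ≤ 7, 0 < A.coeff k := by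
    intro k hk
    rw [hA']
    refine coeff_X_add_C_prod_pos _ (fun a ha => ?_) k (by simpa [hcard] using hk)
    obtain ⟨x, hx, rfl⟩ := Multiset.mem_map.1 ha
    exact neg_pos.2 (hlt x hx)
  have hQmonic : Q.Monic := by
    rw [← hPQ] at hP
    exact hAmonic.of_mul_monic_left hP
  have hQdeg : Q.natDegree = 2 := by omega
  have hQ2 : Q.coeff 2 = 1 := hQdeg ▸ hQmonic.coeff_natDegree
  have hQ : Q = X ^ 2 + C (Q.coeff 1) * X + C (Q.coeff 0) := by
    conv_lhs => rw [Q.as_sum_range_C_mul_X_pow, hQdeg]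
    simp only [Finset.sum_range_succ, Finset.sum_range_zero, hQ2, C_1]
    ring
  have hcoeff : ∀ k, P.coeff (k + 2) =
      A.coeff k + Q.coeff 1 * A.coeff (k + 1) + Q.coeff 0 * A.coeff (k + 2) := by
    intro k
    rw [← hPQ]
    conv_lhs => rw [hQ]
    rw [mul_add, mul_add, coeff_add, coeff_add, coeff_mul_X_pow, coeff_mul_C, ← mul_assoc,
      coeff_mul_X, coeff_mul_C]
    ring
  have hrevcoeff : ∀ k ≤ 7, A.reverse.coeff k = A.coeff (7 - k) := by
    intro k hk
    rw [coeff_reverse, hAdeg, revAt_le hk]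
  have hrevdeg : A.reverse.natDegree = 7 := by
    apply natDegree_eq_of_le_of_coeff_ne_zero ((reverse_natDegree_le A).trans hAdeg.le)
    rw [hrevcoeff 7 le_rfl]
    exact (hApos _ (by norm_num)).ne'
  obtain ⟨i₁, i₂, -⟩ := hAsplits.septic_coeff_ineq hAdeg hApos
  obtain ⟨j₁, -, j₃⟩ := hAsplits.reverse.septic_coeff_ineq hrevdeg fun k hk => by
    rw [hrevcoeff k hk]; exact hApos _ (by omega)
  simp only [hrevcoeff 3 (by norm_num), hrevcoeff 4 (by norm_num), hrevcoeff 5 (by norm_num),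
    hrevcoeff 6 (by norm_num), Nat.reduceSub] at j₁ j₃
  rw [hcoeff 4] at h6
  rw [hcoeff 1] at h3
  exact not_both_quadratics_neg (hApos 6 (by norm_num)) (hApos 5 (by norm_num))
    (hApos 4 (by norm_num)) (hApos 3 (by norm_num)) (hApos 2 (by norm_num)) i₁ i₂ j₁ j₃
    (hQmonic.coeff_one_sq_lt hQdeg hQroots) h6 h3
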